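/- Let 0 < α < 1 and x₀ > 0 be fixed. Then the limit as θ → 0⁺ of R_{x₀}/θ exists and equals (α(α−1)/(2i)³) · ∫_{x₀}^∞ y^(α−2) e^(−2iy) dy. -/

import Mathlib

open MeasureTheory Set Filter Topology

noncomputable section

/-- The wave speed profile `c(x) = (1 + θ (x₊)^α)^(-1/2)`. -/
def spd (α θ x : ℝ) : ℝ := (1 + θ * (max x 0) ^ α) ^ (-(1 / 2) : ℝ)

/-- The WKB amplitude `b(x) = c(x)^(1/2)`. -/
def amp (α θ x : ℝ) : ℝ := spd α θ x ^ ((1 : ℝ) / 2)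

/-- The WKB phase `φ(x) = ∫₀ˣ c(y)⁻¹ dy`. -/
def phase (α θ x : ℝ) : ℝ := ∫ y in (0:ℝ)..x, (spd α θ y)⁻¹

/-- `M(x) = c(x)^(1/2) (c^(1/2))''(x)` for `x > 0`, and `0` for `x ≤ 0`. -/
def Mfun (α θ x : ℝ) : ℝ :=
  if 0 < x then
    spd α θ x ^ ((1 : ℝ) / 2) * deriv (deriv (fun y => spd α θ y ^ ((1 : ℝ) / 2))) x
  else 0

/-- `M_{x₀} = ∫_{x₀}^∞ |M(x)| dx`. -/
def Mtail (α θ x₀ : ℝ) : ℝ := ∫ x in Ioi x₀, |Mfun α θ x|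

/-- The Volterra operator `K_σ`. -/
def Kop (α θ x₀ σ : ℝ) (f : ℝ → ℂ) (x : ℝ) : ℂ :=
  (2 * Complex.I * (1 + Complex.I * (σ : ℂ)))⁻¹ *
    ((∫ y in x₀..x, (Mfun α θ y : ℂ) * f y *
        Complex.exp (-2 * Complex.I * (1 + Complex.I * (σ : ℂ)) *
          ((phase α θ x - phase α θ y : ℝ) : ℂ))) +
      ∫ y in Ioi x, (Mfun α θ y : ℂ) * f y)

/-- The right-going WKB wave `v^> = b e^{-iφ}`. -/
def vplus (α θ x : ℝ) : ℂ := (amp α θ x : ℂ) * Complex.exp (-Complex.I * (phase α θ x : ℂ))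

/-- The left-going WKB wave `v^< = b e^{iφ}`. -/
def vminus (α θ x : ℝ) : ℂ := (amp α θ x : ℂ) * Complex.exp (Complex.I * (phase α θ x : ℂ))

/-- `S` is a bounded continuous solution on `[x₀,∞)` of `S = e^{-2iφ} + K₀ S`. -/
def IsVolterraSol (α θ x₀ : ℝ) (S : ℝ → ℂ) : Prop :=
  (∃ C, ∀ x ∈ Ici x₀, ‖S x‖ ≤ C) ∧ ContinuousOn S (Ici x₀) ∧
    ∀ x ∈ Ici x₀, S x = Complex.exp (-2 * Complex.I * (phase α θ x : ℂ)) + Kop α θ x₀ 0 S x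

/-- `R_{x₀} = (2i)⁻¹ ∫_{x₀}^∞ M S^>`. -/
def Rx (α θ x₀ : ℝ) (S : ℝ → ℂ) : ℂ :=
  (2 * Complex.I)⁻¹ * ∫ x in Ioi x₀, (Mfun α θ x : ℂ) * S x

theorem spd_rpow_half_eq {α θ x : ℝ} (hθ : 0 < θ) (hx : 0 < x) :
    spd α θ x ^ ((1 : ℝ) / 2) = (1 + θ * x ^ α) ^ (-(1 / 4) : ℝ) := by
  have hu : 0 < 1 + θ * x ^ α := by positivity
  rw [spd, max_eq_left hx.le, ← Real.rpow_mul hu.le]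
  norm_num

theorem hasDerivAt_one_add_mul_rpow_rpow (α p : ℝ) {θ x : ℝ} (hθ : 0 < θ) (hx : 0 < x) :
    HasDerivAt (fun y : ℝ => (1 + θ * y ^ α) ^ p)
      (θ * (α * x ^ (α - 1)) * p * (1 + θ * x ^ α) ^ (p - 1)) x := by
  have hu : 0 < 1 + θ * x ^ α := by positivity
  exact (((Real.hasDerivAt_rpow_const (Or.inl hx.ne')).const_mul θ).const_add 1).rpow_const
    (Or.inl hu.ne')

/-- Closed form of `M` on the positive half-line. -/
theorem Mfun_eq {α θ x : ℝ} (hθ : 0 < θ) (hx : 0 < x) :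
    Mfun α θ x = θ * (x ^ (α - 2) * (1 + θ * x ^ α) ^ (-(3 / 2) : ℝ) *
      (-(1 / 4) * (α * (α - 1)) + 5 / 16 * α ^ 2 * (θ * x ^ α / (1 + θ * x ^ α)))) := by
  have hu : 0 < 1 + θ * x ^ α := by positivity
  have h1 : ∀ y, 0 < y → deriv (fun y => spd α θ y ^ ((1 : ℝ) / 2)) y =
      θ * (α * y ^ (α - 1)) * (-(1 / 4)) * (1 + θ * y ^ α) ^ (-(1 / 4) - 1 : ℝ) := by
    intro y hy
    rw [← (hasDerivAt_one_add_mul_rpow_rpow α (-(1 / 4)) hθ hy).deriv]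
    apply Filter.EventuallyEq.deriv_eq
    filter_upwards [lt_mem_nhds hy] with z hz using spd_rpow_half_eq hθ hz
  have h2 : deriv (deriv (fun y => spd α θ y ^ ((1 : ℝ) / 2))) x =
      θ * (α * ((α - 1) * x ^ (α - 1 - 1))) * (-(1 / 4)) *
        (1 + θ * x ^ α) ^ (-(1 / 4) - 1 : ℝ) +
      θ * (α * x ^ (α - 1)) * (-(1 / 4)) * (θ * (α * x ^ (α - 1)) * (-(1 / 4) - 1) *
        (1 + θ * x ^ α) ^ (-(1 / 4) - 1 - 1 : ℝ)) := by
    rw [Filter.EventuallyEq.deriv_eq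
      (f := fun y => θ * (α * y ^ (α - 1)) * (-(1 / 4)) * (1 + θ * y ^ α) ^ (-(1 / 4) - 1 : ℝ))
      (by filter_upwards [lt_mem_nhds hx] with z hz using h1 z hz)]
    exact (((((Real.hasDerivAt_rpow_const (p := α - 1) (Or.inl hx.ne')).const_mul α).const_mul
      θ).mul_const (-(1 / 4))).mul (hasDerivAt_one_add_mul_rpow_rpow α (-(1 / 4) - 1) hθ hx)).deriv
  rw [Mfun, if_pos hx, h2, spd_rpow_half_eq hθ hx]
  set u := 1 + θ * x ^ α with hudef
  have e1 : x ^ (α - 1 - 1) = x ^ (α - 2) := by ring_nf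
  have e2 : x ^ (α - 1) * x ^ (α - 1) = x ^ (α - 2) * x ^ α := by
    rw [← Real.rpow_add hx, ← Real.rpow_add hx]; ring_nf
  have e3 : u ^ (-(1 / 4) : ℝ) * u ^ (-(1 / 4) - 1 : ℝ) = u ^ (-(3 / 2) : ℝ) := by
    rw [← Real.rpow_add hu]; norm_num
  have e4 : u ^ (-(1 / 4) : ℝ) * u ^ (-(1 / 4) - 1 - 1 : ℝ) = u ^ (-(3 / 2) : ℝ) / u := by
    rw [← Real.rpow_add hu, ← Real.rpow_sub_one hu.ne']; norm_num
  rw [e1]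
  linear_combination (-(1 / 4) * θ * α * (α - 1) * x ^ (α - 2)) * e3 +
    (5 / 16 * θ ^ 2 * α ^ 2 * x ^ (α - 1) * x ^ (α - 1)) * e4 +
    (5 / 16 * θ ^ 2 * α ^ 2 * (u ^ (-(3 / 2) : ℝ) / u)) * e2

theorem abs_Mfun_le {α θ x : ℝ} (hα0 : 0 < α) (hα1 : α < 1) (hθ : 0 < θ) (hx : 0 < x) :
    |Mfun α θ x| ≤ θ * x ^ (α - 2) := by
  have ht : 0 < θ * x ^ α := by positivity
  rw [Mfun_eq hθ hx]
  set t := θ * x ^ α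
  have hq0 : 0 ≤ t / (1 + t) := by positivity
  have hq1 : t / (1 + t) ≤ 1 := by rw [div_le_one (by positivity)]; linarith
  have hp : (1 + t) ^ (-(3 / 2) : ℝ) ≤ 1 :=
    Real.rpow_le_one_of_one_le_of_nonpos (by linarith) (by norm_num)
  have hp0 : 0 ≤ (1 + t) ^ (-(3 / 2) : ℝ) := by positivity
  have hx2 : 0 ≤ x ^ (α - 2) := by positivity
  have hb : |-(1 / 4) * (α * (α - 1)) + 5 / 16 * α ^ 2 * (t / (1 + t))| ≤ 1 := by
    have h1 : 0 ≤ α * (1 - α) := mul_nonneg hα0.le (by linarith)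
    have h2 : 0 ≤ α ^ 2 * (t / (1 + t)) := by positivity
    have h3 : α ^ 2 * (t / (1 + t)) ≤ 1 := mul_le_one₀ (by nlinarith) hq0 hq1
    rw [abs_le]
    constructor <;> nlinarith
  rw [abs_mul, abs_mul, abs_mul, abs_of_pos hθ, abs_of_nonneg hx2, abs_of_nonneg hp0]
  refine mul_le_mul_of_nonneg_left ?_ hθ.le
  calc _ ≤ x ^ (α - 2) * 1 * 1 := by gcongr
    _ = _ := by ring

theorem continuousOn_Mfun {α θ : ℝ} (hθ : 0 < θ) : ContinuousOn (Mfun α θ) (Ioi 0) := by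
  refine ContinuousOn.congr (f := fun x => θ * (x ^ (α - 2) * (1 + θ * x ^ α) ^ (-(3 / 2) : ℝ) *
    (-(1 / 4) * (α * (α - 1)) + 5 / 16 * α ^ 2 * (θ * x ^ α / (1 + θ * x ^ α))))) ?_
    fun x hx => Mfun_eq hθ hx
  intro x hx
  have hx : 0 < x := hx
  have hu : 1 + θ * x ^ α ≠ 0 := by positivity
  have h (p : ℝ) : ContinuousAt (fun x : ℝ => x ^ p) x :=
    Real.continuousAt_rpow_const _ _ (Or.inl hx.ne')
  have hc : ContinuousAt (fun x : ℝ => 1 + θ * x ^ α) x := ((h α).const_mul θ).const_add 1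
  exact ((((h (α - 2)).mul (hc.rpow_const (Or.inl hu))).mul
    ((((h α).const_mul θ).div hc hu).const_mul _ |>.const_add _)).const_mul θ).continuousWithinAt

theorem tendsto_one_add_mul_nhdsGT_zero (a : ℝ) :
    Tendsto (fun θ : ℝ => 1 + θ * a) (𝓝[>] 0) (𝓝 1) := by
  have : Tendsto (fun θ : ℝ => 1 + θ * a) (𝓝 0) (𝓝 (1 + 0 * a)) :=
    Continuous.tendsto (by fun_prop) 0
  simpa using this.mono_left nhdsWithin_le_nhds

theorem tendsto_Mfun_div {α x : ℝ} (hx : 0 < x) :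
    Tendsto (fun θ => Mfun α θ x / θ) (𝓝[>] 0)
      (𝓝 (-(1 / 4) * (α * (α - 1)) * x ^ (α - 2))) := by
  have hu := tendsto_one_add_mul_nhdsGT_zero (x ^ α)
  have ht : Tendsto (fun θ : ℝ => θ * x ^ α) (𝓝[>] 0) (𝓝 0) := by
    simpa using hu.sub_const 1
  have h := ((hu.rpow_const (p := -(3 / 2)) (Or.inl one_ne_zero)).const_mul (x ^ (α - 2))).mul
    (((ht.div hu one_ne_zero).const_mul (5 / 16 * α ^ 2)).const_add (-(1 / 4) * (α * (α - 1))))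
  have e : x ^ (α - 2) * (1 : ℝ) ^ (-(3 / 2) : ℝ) *
      (-(1 / 4) * (α * (α - 1)) + 5 / 16 * α ^ 2 * (0 / 1)) =
      -(1 / 4) * (α * (α - 1)) * x ^ (α - 2) := by
    rw [Real.one_rpow]; ring
  rw [e] at h
  refine h.congr' ?_
  filter_upwards [self_mem_nhdsWithin] with θ hθ
  have hθ : 0 < θ := hθ
  rw [Mfun_eq hθ hx, mul_div_cancel_left₀ _ hθ.ne']
  rfl

theorem continuous_inv_spd {α θ : ℝ} (hα : 0 < α) (hθ : 0 < θ) :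
    Continuous fun y => (spd α θ y)⁻¹ := by
  have hu (y : ℝ) : 0 < 1 + θ * max y 0 ^ α := by positivity
  have hc : Continuous fun y : ℝ => 1 + θ * max y 0 ^ α :=
    ((continuous_id.max continuous_const).rpow_const (fun _ => Or.inr hα.le)).const_mul θ
      |>.const_add 1
  exact (hc.rpow_const fun y => Or.inl (hu y).ne').inv₀ fun y => (Real.rpow_pos_of_pos (hu y) _).ne'

theorem abs_phase_sub_le {α θ x : ℝ} (hα : 0 < α) (hθ : 0 < θ) (hx : 0 < x) :
    |phase α θ x - x| ≤ θ * x ^ α * x := by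
  have h : phase α θ x - x = ∫ y in (0:ℝ)..x, ((spd α θ y)⁻¹ - 1) := by
    rw [intervalIntegral.integral_sub ((continuous_inv_spd hα hθ).intervalIntegrable _ _)
      intervalIntegrable_const]
    simp [phase]
  rw [h, ← Real.norm_eq_abs]
  refine (intervalIntegral.norm_integral_le_of_norm_le_const (C := θ * x ^ α) ?_).trans_eq
    (by rw [sub_zero, abs_of_pos hx])
  intro y hy
  rw [uIoc_of_le hx.le] at hy
  have hy0 : 0 < y := hy.1
  have ht : 0 < θ * y ^ α := by positivity
  have hle : θ * y ^ α ≤ θ * x ^ α := by gcongr; exact hy.2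
  have e : (spd α θ y)⁻¹ = (1 + θ * y ^ α) ^ ((1 : ℝ) / 2) := by
    rw [spd, max_eq_left hy0.le, Real.rpow_neg (by positivity), inv_inv]
  have h1 : 1 ≤ (1 + θ * y ^ α) ^ ((1 : ℝ) / 2) :=
    Real.one_le_rpow (by linarith) (by norm_num)
  have h2 : (1 + θ * y ^ α) ^ ((1 : ℝ) / 2) ≤ 1 + θ * y ^ α :=
    Real.rpow_le_self_of_one_le (by linarith) (by norm_num)
  rw [e, Real.norm_eq_abs, abs_of_nonneg (by linarith)]
  linarith

theorem tendsto_phase {α x : ℝ} (hα : 0 < α) (hx : 0 < x) :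
    Tendsto (fun θ => phase α θ x) (𝓝[>] 0) (𝓝 x) := by
  rw [tendsto_iff_norm_sub_tendsto_zero]
  have ht : Tendsto (fun θ : ℝ => θ * x ^ α * x) (𝓝[>] 0) (𝓝 0) := by
    simpa [mul_assoc] using (tendsto_one_add_mul_nhdsGT_zero (x ^ α * x)).sub_const 1
  refine squeeze_zero' (Eventually.of_forall fun _ => norm_nonneg _) ?_ ht
  filter_upwards [self_mem_nhdsWithin] with θ hθ using abs_phase_sub_le hα hθ hx

theorem norm_Kop_zero_le {α θ x₀ B x : ℝ} {f : ℝ → ℂ} (hα0 : 0 < α) (hα1 : α < 1) (hθ : 0 < θ)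
    (hx₀ : 0 < x₀) (hB : ∀ y ∈ Ici x₀, ‖f y‖ ≤ B) (hx : x ∈ Ici x₀) :
    ‖Kop α θ x₀ 0 f x‖ ≤ θ * (∫ y in Ioi x₀, y ^ (α - 2)) / 2 * B := by
  have hx : x₀ ≤ x := hx
  have hint : IntegrableOn (fun y : ℝ => θ * y ^ (α - 2) * B) (Ioi x₀) :=
    ((integrableOn_Ioi_rpow_of_lt (by linarith) hx₀).const_mul θ).mul_const B
  have hM (y : ℝ) (hy : x₀ ≤ y) : ‖(Mfun α θ y : ℂ) * f y‖ ≤ θ * y ^ (α - 2) * B := by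
    have hy0 : 0 < y := hx₀.trans_le hy
    rw [norm_mul, Complex.norm_real, Real.norm_eq_abs]
    exact mul_le_mul (abs_Mfun_le hα0 hα1 hθ hy0) (hB y hy) (norm_nonneg _) (by positivity)
  have h1 : ‖∫ y in x₀..x, (Mfun α θ y : ℂ) * f y * Complex.exp (-2 * Complex.I *
      (1 + Complex.I * ((0 : ℝ) : ℂ)) * ((phase α θ x - phase α θ y : ℝ) : ℂ))‖ ≤
      ∫ y in Ioc x₀ x, θ * y ^ (α - 2) * B := by
    rw [intervalIntegral.integral_of_le hx]
    refine norm_integral_le_of_norm_le (hint.mono_set Ioc_subset_Ioi_self) ?_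
    refine (ae_restrict_iff' measurableSet_Ioc).2 (Eventually.of_forall fun y hy => ?_)
    rw [norm_mul, Complex.norm_exp]
    simpa using hM y hy.1.le
  have h2 : ‖∫ y in Ioi x, (Mfun α θ y : ℂ) * f y‖ ≤ ∫ y in Ioi x, θ * y ^ (α - 2) * B := by
    refine norm_integral_le_of_norm_le (hint.mono_set (Ioi_subset_Ioi hx)) ?_
    refine (ae_restrict_iff' measurableSet_Ioi).2 (Eventually.of_forall fun y hy => ?_)
    exact hM y (hx.trans (le_of_lt hy))
  have h3 : (∫ y in Ioc x₀ x, θ * y ^ (α - 2) * B) + ∫ y in Ioi x, θ * y ^ (α - 2) * B =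
      θ * (∫ y in Ioi x₀, y ^ (α - 2)) * B := by
    rw [← setIntegral_union (Ioc_disjoint_Ioi le_rfl) measurableSet_Ioi
      (hint.mono_set Ioc_subset_Ioi_self) (hint.mono_set (Ioi_subset_Ioi hx)),
      Ioc_union_Ioi_eq_Ioi hx, integral_mul_const, integral_const_mul]
  rw [Kop, norm_mul]
  have h4 : ‖(2 * Complex.I * (1 + Complex.I * ((0 : ℝ) : ℂ)))⁻¹‖ = 1 / 2 := by simp
  rw [h4]
  have h5 := norm_add_le_of_le h1 h2
  rw [h3] at h5
  linarith

theorem norm_exp_neg_two_I_mul (t : ℝ) : ‖Complex.exp (-2 * Complex.I * (t : ℂ))‖ = 1 := by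
  rw [Complex.norm_exp]; simp

theorem IsVolterraSol.norm_le_two {α θ x₀ : ℝ} {S : ℝ → ℂ} (hα0 : 0 < α) (hα1 : α < 1)
    (hθ : 0 < θ) (hx₀ : 0 < x₀) (hJ : θ * (∫ y in Ioi x₀, y ^ (α - 2)) ≤ 1)
    (hS : IsVolterraSol α θ x₀ S) {x : ℝ} (hx : x ∈ Ici x₀) : ‖S x‖ ≤ 2 := by
  obtain ⟨⟨C, hC⟩, -, heq⟩ := hS
  have hne : (range fun y : Ici x₀ => ‖S y‖).Nonempty := ⟨_, ⟨⟨x₀, self_mem_Ici⟩, rfl⟩⟩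
  have hbdd : BddAbove (range fun y : Ici x₀ => ‖S y‖) :=
    ⟨C, by rintro _ ⟨y, rfl⟩; exact hC y y.2⟩
  set B := sSup (range fun y : Ici x₀ => ‖S y‖)
  have hB : ∀ y ∈ Ici x₀, ‖S y‖ ≤ B := fun y hy => le_csSup hbdd ⟨⟨y, hy⟩, rfl⟩
  have hB0 : 0 ≤ B := (norm_nonneg _).trans (hB x hx)
  have hle : B ≤ 1 + B / 2 := by
    refine csSup_le hne ?_
    rintro _ ⟨y, rfl⟩
    have hK := norm_Kop_zero_le hα0 hα1 hθ hx₀ hB y.2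
    have hS := norm_add_le_of_le (norm_exp_neg_two_I_mul (phase α θ y)).le hK
    rw [← heq y y.2] at hS
    have := mul_le_mul_of_nonneg_right hJ hB0
    change ‖S y‖ ≤ _
    linarith
  linarith [hB x hx]

/-- limit of `R_{x₀}/θ` as `θ → 0⁺` for `0 < α < 1`. -/
theorem stmt7 (α x₀ : ℝ) (hα0 : 0 < α) (hα1 : α < 1) (hx₀ : 0 < x₀)
    (Rf : ℝ → ℂ)
    (hRf : ∀ᶠ θ in 𝓝[>] (0:ℝ), ∃ S : ℝ → ℂ, IsVolterraSol α θ x₀ S ∧ Rf θ = Rx α θ x₀ S) :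
    Tendsto (fun θ : ℝ => Rf θ / (θ : ℂ)) (𝓝[>] (0:ℝ))
      (𝓝 (((α * (α - 1) : ℝ) : ℂ) / (2 * Complex.I) ^ (3 : ℕ) *
        ∫ y in Ioi x₀, ((y ^ (α - 2) : ℝ) : ℂ) * Complex.exp (-2 * Complex.I * (y : ℂ)))) := by
  obtain ⟨S, hS⟩ := hRf.choice
  set J := ∫ y in Ioi x₀, y ^ (α - 2)
  have hθpos : ∀ᶠ θ : ℝ in 𝓝[>] 0, 0 < θ := self_mem_nhdsWithin
  have hJt : Tendsto (fun θ : ℝ => θ * J) (𝓝[>] 0) (𝓝 0) := by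
    simpa using (tendsto_one_add_mul_nhdsGT_zero J).sub_const 1
  have hJ : ∀ᶠ θ : ℝ in 𝓝[>] 0, θ * J ≤ 1 := hJt.eventually (ge_mem_nhds one_pos)
  have hlim (x : ℝ) (hx : x₀ < x) :
      Tendsto (fun θ => S θ x) (𝓝[>] 0) (𝓝 (Complex.exp (-2 * Complex.I * (x : ℂ)))) := by
    have hexp : Tendsto (fun θ => Complex.exp (-2 * Complex.I * (phase α θ x : ℂ))) (𝓝[>] 0)
        (𝓝 (Complex.exp (-2 * Complex.I * (x : ℂ)))) :=
      (Continuous.tendsto (f := fun t : ℝ => Complex.exp (-2 * Complex.I * (t : ℂ)))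
        (by fun_prop) x).comp (tendsto_phase hα0 (hx₀.trans hx))
    have hK : Tendsto (fun θ => Kop α θ x₀ 0 (S θ) x) (𝓝[>] 0) (𝓝 0) := by
      refine squeeze_zero_norm' ?_ hJt
      filter_upwards [hS, hθpos, hJ] with θ hSθ hθ hJθ
      have := norm_Kop_zero_le hα0 hα1 hθ hx₀
        (fun y hy => hSθ.1.norm_le_two hα0 hα1 hθ hx₀ hJθ hy) hx.le
      linarith
    have := hexp.add hK
    rw [add_zero] at this
    refine this.congr' ?_
    filter_upwards [hS] with θ hSθ using (hSθ.1.2.2 x hx.le).symm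
  have hI : Tendsto (fun θ => ∫ x in Ioi x₀, ((Mfun α θ x / θ : ℝ) : ℂ) * S θ x) (𝓝[>] 0)
      (𝓝 (∫ x in Ioi x₀, ((-(1 / 4) * (α * (α - 1)) * x ^ (α - 2) : ℝ) : ℂ) *
        Complex.exp (-2 * Complex.I * (x : ℂ)))) := by
    refine tendsto_integral_filter_of_dominated_convergence (fun x => x ^ (α - 2) * 2) ?_ ?_
      ((integrableOn_Ioi_rpow_of_lt (by linarith) hx₀).mul_const 2) ?_
    · filter_upwards [hS, hθpos] with θ hSθ hθ
      refine ContinuousOn.aestronglyMeasurable ?_ measurableSet_Ioi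
      refine ContinuousOn.mul ?_ (hSθ.1.2.1.mono Ioi_subset_Ici_self)
      exact Complex.continuous_ofReal.comp_continuousOn
        (((continuousOn_Mfun hθ).mono (Ioi_subset_Ioi hx₀.le)).div_const θ)
    · filter_upwards [hS, hθpos, hJ] with θ hSθ hθ hJθ
      refine (ae_restrict_iff' measurableSet_Ioi).2 (Eventually.of_forall fun x hx => ?_)
      have hx : x₀ < x := hx
      have hx0 : 0 < x := hx₀.trans hx
      have hM := abs_Mfun_le hα0 hα1 hθ hx0
      rw [norm_mul, Complex.norm_real, Real.norm_eq_abs, abs_div, abs_of_pos hθ]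
      refine mul_le_mul ?_ (hSθ.1.norm_le_two hα0 hα1 hθ hx₀ hJθ hx.le) (norm_nonneg _)
        (by positivity)
      rwa [div_le_iff₀' hθ]
    · refine (ae_restrict_iff' measurableSet_Ioi).2 (Eventually.of_forall fun x hx => ?_)
      exact ((Complex.continuous_ofReal.tendsto _).comp
        (tendsto_Mfun_div (hx₀.trans hx))).mul (hlim x hx)
  have hconst : (2 * Complex.I)⁻¹ *
      ∫ x in Ioi x₀, ((-(1 / 4) * (α * (α - 1)) * x ^ (α - 2) : ℝ) : ℂ) *
        Complex.exp (-2 * Complex.I * (x : ℂ)) =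
      ((α * (α - 1) : ℝ) : ℂ) / (2 * Complex.I) ^ (3 : ℕ) *
        ∫ y in Ioi x₀, ((y ^ (α - 2) : ℝ) : ℂ) * Complex.exp (-2 * Complex.I * (y : ℂ)) := by
    have hc : (2 * Complex.I) ^ 3 = 2 * Complex.I * (-4) := by
      linear_combination 8 * Complex.I * Complex.I_sq
    simp only [Complex.ofReal_mul (-(1 / 4) * (α * (α - 1))), mul_assoc ((_ : ℝ) : ℂ)]
    rw [integral_const_mul, ← mul_assoc, hc]
    congr 1
    push_cast
    field_simp
  rw [← hconst]
  refine (hI.const_mul _).congr' ?_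
  filter_upwards [hS] with θ hSθ
  rw [hSθ.2, Rx, mul_div_assoc, ← integral_div]
  congr 2 with x
  push_cast
  ring
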